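/- Let V = V_d(p) with d ≥ 1 and p prime, and let S = (V, 𝓛) be a G-affine proper partial linear space where G is an affine permutation group of rank 3 on V. Then one of the following holds: (i) every line of S is an affine subspace of V; (ii) the translation group acts semiregularly on 𝓛 (no nonzero translation fixes any line setwise), all lines of S have a common size k, and k(k − 1) divides |x^{G_0}| for every x ∈ S(0), where S(0) denotes the set of vectors collinear with 0. -/

import Mathlib

open scoped Pointwise

/-- A partial linear space on the point set `P`: a set of lines (subsets of `P`) such that
any two distinct points lie on at most one common line and every line has at least two
points. -/
structure PLS (P : Type*) where
  lines : Set (Set P)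
  two_le_ncard : ∀ L ∈ lines, 2 ≤ L.ncard
  unique_of_pair : ∀ L₁ ∈ lines, ∀ L₂ ∈ lines, ∀ x y : P,
    x ≠ y → x ∈ L₁ → y ∈ L₁ → x ∈ L₂ → y ∈ L₂ → L₁ = L₂

namespace PLS

variable {P : Type*}

/-- Two points are collinear if they are distinct and lie on a common line. -/
def Collinear (S : PLS P) (x y : P) : Prop :=
  x ≠ y ∧ ∃ L ∈ S.lines, x ∈ L ∧ y ∈ L

/-- The set of points collinear with `x`. -/
def nbrs (S : PLS P) (x : P) : Set P :=
  {y : P | S.Collinear x y}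

/-- A linear space: any two distinct points lie on exactly one line. -/
def IsLinearSpace (S : PLS P) : Prop :=
  ∀ x y : P, x ≠ y → ∃! L, L ∈ S.lines ∧ x ∈ L ∧ y ∈ L

/-- A graph: every line has exactly two points. -/
def IsGraph (S : PLS P) : Prop :=
  ∀ L ∈ S.lines, L.ncard = 2

/-- Proper: neither a linear space nor a graph. -/
def IsProper (S : PLS P) : Prop :=
  ¬ S.IsLinearSpace ∧ ¬ S.IsGraph

/-- The automorphism group of `S`: all permutations of the point set mapping the line set
onto itself. -/
def aut (S : PLS P) : Subgroup (Equiv.Perm P) :=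
  MulAction.stabilizer (Equiv.Perm P) S.lines

end PLS

/-- The orbit of `x` under the stabiliser of `0` in `G`. -/
def zeroStabOrbit {V : Type*} [AddCommGroup V] (G : Subgroup (Equiv.Perm V)) (x : V) : Set V :=
  {y : V | ∃ g ∈ G, g 0 = 0 ∧ g x = y}

/-- `G` is an affine permutation group on `V`: it contains all translations, and every
element fixing `0` is additive. -/
def IsAffinePermGroup {V : Type*} [AddCommGroup V] (G : Subgroup (Equiv.Perm V)) : Prop :=
  (∀ v : V, Equiv.addRight v ∈ G) ∧
    ∀ g ∈ G, g 0 = 0 → ∀ x y : V, g (x + y) = g x + g y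

/-- The stabiliser of `0` in `G` has exactly two orbits on the set of nonzero vectors;
for an affine permutation group this says exactly that `G` has rank `3`. -/
def HasTwoZeroStabOrbits {V : Type*} [AddCommGroup V] (G : Subgroup (Equiv.Perm V)) : Prop :=
  ∃ x y : V, x ≠ 0 ∧ y ≠ 0 ∧ zeroStabOrbit G x ≠ zeroStabOrbit G y ∧
    ∀ z : V, z ≠ 0 → z ∈ zeroStabOrbit G x ∪ zeroStabOrbit G y

namespace PLS

variable {V : Type*}

theorem image_mem_lines {S : PLS V} {g : Equiv.Perm V} (hg : g ∈ S.aut) {L : Set V}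
    (hL : L ∈ S.lines) : g '' L ∈ S.lines := by
  have h : g • S.lines = S.lines := hg
  rw [← h]
  exact Set.smul_mem_smul_set hL

/-- Every line has a point other than a given one. -/
theorem exists_mem_ne (S : PLS V) {L : Set V} (hL : L ∈ S.lines) (a : V) : ∃ x ∈ L, x ≠ a :=
  Set.exists_ne_of_one_lt_ncard (S.two_le_ncard L hL) a

/-- All translations are automorphisms of `S`. -/
def IsTranslationInvariant [AddCommGroup V] (S : PLS V) : Prop :=
  ∀ v : V, ∀ L ∈ S.lines, (fun y : V => y + v) '' L ∈ S.lines

/-- The differences of pairs of distinct points of `L`. -/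
def differences [AddCommGroup V] (L : Set V) : Set V :=
  (fun q : V × V => q.1 - q.2) '' L.offDiag

section Translations

variable [AddCommGroup V] {S : PLS V}

theorem IsTranslationInvariant.exists_line (hT : S.IsTranslationInvariant) {L : Set V}
    (hL : L ∈ S.lines) {a b : V} (ha : a ∈ L) (hb : b ∈ L) :
    (fun y : V => y + -a) '' L ∈ S.lines ∧ 0 ∈ (fun y : V => y + -a) '' L ∧
      b - a ∈ (fun y : V => y + -a) '' L :=
  ⟨hT _ _ hL, ⟨a, ha, add_neg_cancel a⟩, ⟨b, hb, (sub_eq_add_neg b a).symm⟩⟩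

theorem IsTranslationInvariant.isLinearSpace (hT : S.IsTranslationInvariant)
    (h : ∀ z : V, z ≠ 0 → z ∈ S.nbrs 0) : S.IsLinearSpace := by
  intro x y hxy
  obtain ⟨-, L, hL, h0, hz⟩ := h (y - x) (sub_ne_zero.2 hxy.symm)
  have hx : x ∈ (fun w : V => w + x) '' L := ⟨0, h0, zero_add x⟩
  have hy : y ∈ (fun w : V => w + x) '' L := ⟨y - x, hz, sub_add_cancel y x⟩
  exact ⟨_, ⟨hT x L hL, hx, hy⟩, fun M hM =>
    S.unique_of_pair _ hM.1 _ (hT x L hL) x y hxy hM.2.1 hM.2.2 hx hy⟩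

/-- Two lines sharing a nonzero difference are translates of each other. -/
theorem IsTranslationInvariant.translate_eq (hT : S.IsTranslationInvariant) {L M : Set V}
    (hL : L ∈ S.lines) (hM : M ∈ S.lines) {a b c d : V} (ha : a ∈ L) (hb : b ∈ L)
    (hc : c ∈ M) (hd : d ∈ M) (hab : a ≠ b) (h : a - b = c - d) :
    (fun y : V => y + (d - b)) '' L = M := by
  refine S.unique_of_pair _ (hT _ L hL) _ hM c d ?_ ⟨a, ha, ?_⟩ ⟨b, hb, ?_⟩ hc hd
  · rw [← sub_ne_zero, ← h]
    exact sub_ne_zero.2 hab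
  · show a + (d - b) = c
    rw [← sub_add_cancel c d, ← h]
    abel
  · exact add_sub_cancel b d

theorem differences_image_add (L : Set V) (v : V) :
    differences ((fun y : V => y + v) '' L) = differences L := by
  ext z
  constructor
  · rintro ⟨⟨_, _⟩, ⟨⟨a, ha, rfl⟩, ⟨b, hb, rfl⟩, hab⟩, rfl⟩
    exact ⟨(a, b), ⟨ha, hb, fun h => hab (congrArg (· + v) h)⟩,
      (add_sub_add_right_eq_sub a b v).symm⟩
  · rintro ⟨⟨a, b⟩, ⟨ha, hb, hab⟩, rfl⟩
    exact ⟨(a + v, b + v), ⟨⟨a, ha, rfl⟩, ⟨b, hb, rfl⟩, fun h => hab (add_right_cancel h)⟩,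
      add_sub_add_right_eq_sub a b v⟩

theorem IsTranslationInvariant.nbrs_zero (hT : S.IsTranslationInvariant) :
    S.nbrs 0 = ⋃ D ∈ differences '' S.lines, id D := by
  ext z
  simp only [Set.mem_iUnion, Set.exists_mem_image, exists_prop, id]
  constructor
  · rintro ⟨hz, L, hL, h0, hzL⟩
    exact ⟨L, hL, (z, 0), ⟨hzL, h0, hz.symm⟩, sub_zero z⟩
  · rintro ⟨L, hL, ⟨a, b⟩, ⟨ha, hb, hab⟩, rfl⟩
    exact ⟨(sub_ne_zero.2 hab).symm, _, hT.exists_line hL hb ha⟩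

theorem IsTranslationInvariant.pairwiseDisjoint_differences (hT : S.IsTranslationInvariant) :
    (differences '' S.lines).PairwiseDisjoint id := by
  rintro _ ⟨L, hL, rfl⟩ _ ⟨M, hM, rfl⟩ hne
  rw [Function.onFun, id, id, Set.disjoint_left]
  rintro _ ⟨⟨a, b⟩, ⟨ha, hb, hab⟩, rfl⟩ ⟨⟨c, d⟩, ⟨hc, hd, -⟩, h⟩
  refine hne ?_
  rw [← hT.translate_eq hL hM ha hb hc hd hab h.symm, differences_image_add]

theorem IsTranslationInvariant.ncard_differences [Finite V] (hT : S.IsTranslationInvariant)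
    (hsemi : ∀ v : V, v ≠ 0 → ∀ L ∈ S.lines, (fun y : V => y + v) '' L ≠ L) {L : Set V}
    (hL : L ∈ S.lines) : (differences L).ncard = L.ncard * (L.ncard - 1) := by
  classical
  rw [differences, Set.InjOn.ncard_image]
  · have hfin := L.toFinite
    lift L to Finset V using hfin
    rw [← Finset.coe_offDiag, Set.ncard_coe_finset, Set.ncard_coe_finset, Finset.offDiag_card,
      Nat.mul_sub_one]
  · rintro ⟨a, b⟩ ⟨ha, hb, hab⟩ ⟨c, d⟩ ⟨hc, hd, -⟩ h
    have hdb : d = b := by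
      by_contra hne
      exact hsemi (d - b) (sub_ne_zero.2 hne) L hL (hT.translate_eq hL hL ha hb hc hd hab h)
    subst hdb
    exact Prod.ext (sub_left_injective h) rfl

/-- If the translations act semiregularly on the lines, all of size `k`, then the sets of
differences of the lines partition the neighbours of `0` into parts of size `k * (k - 1)`. -/
theorem IsTranslationInvariant.dvd_ncard_nbrs_zero [Finite V] (hT : S.IsTranslationInvariant)
    (hsemi : ∀ v : V, v ≠ 0 → ∀ L ∈ S.lines, (fun y : V => y + v) '' L ≠ L) {k : ℕ}
    (hk : ∀ L ∈ S.lines, L.ncard = k) : k * (k - 1) ∣ (S.nbrs 0).ncard := by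
  rw [hT.nbrs_zero, (Set.toFinite _).ncard_biUnion (fun _ _ => Set.toFinite _)
    hT.pairwiseDisjoint_differences, finsum_mem_eq_finite_toFinset_sum _ (Set.toFinite _)]
  refine Finset.dvd_sum fun D hD => ?_
  obtain ⟨L, hL, rfl⟩ := (Set.Finite.mem_toFinset _).1 hD
  rw [id, hT.ncard_differences hsemi hL, hk L hL]

end Translations

end PLS

section ZeroStabOrbit

variable {V : Type*} [AddCommGroup V] {G : Subgroup (Equiv.Perm V)}

theorem zeroStabOrbit_symm {x y : V} (h : y ∈ zeroStabOrbit G x) : x ∈ zeroStabOrbit G y := by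
  obtain ⟨g, hg, h0, rfl⟩ := h
  exact ⟨g⁻¹, G.inv_mem hg, Equiv.Perm.inv_eq_iff_eq.2 h0.symm, g.symm_apply_apply x⟩

theorem zeroStabOrbit_trans {x y z : V} (hxy : y ∈ zeroStabOrbit G x)
    (hyz : z ∈ zeroStabOrbit G y) : z ∈ zeroStabOrbit G x := by
  obtain ⟨g, hg, hg0, rfl⟩ := hxy
  obtain ⟨h, hh, hh0, rfl⟩ := hyz
  exact ⟨h * g, G.mul_mem hh hg, by simp [hg0, hh0], rfl⟩

variable {S : PLS V}

theorem PLS.zeroStabOrbit_subset_nbrs (hG : G ≤ S.aut) {x : V} (hx : x ∈ S.nbrs 0) :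
    zeroStabOrbit G x ⊆ S.nbrs 0 := by
  rintro _ ⟨g, hg, h0, rfl⟩
  obtain ⟨hne, L, hL, h0L, hxL⟩ := hx
  refine ⟨fun h => hne (g.injective (h0.trans h)), g '' L, image_mem_lines (hG hg) hL,
    ⟨0, h0L, h0⟩, x, hxL, rfl⟩

theorem PLS.nbrs_zero_eq_zeroStabOrbit (hT : S.IsTranslationInvariant)
    (hS : ¬ S.IsLinearSpace) (hG : G ≤ S.aut) (hrank : HasTwoZeroStabOrbits G) {x : V}
    (hx : x ∈ S.nbrs 0) : S.nbrs 0 = zeroStabOrbit G x := by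
  refine Set.Subset.antisymm (fun z hz => ?_) (zeroStabOrbit_subset_nbrs hG hx)
  obtain ⟨a, b, -, -, -, hab⟩ := hrank
  have key : ¬ (a ∈ S.nbrs 0 ∧ b ∈ S.nbrs 0) := fun ⟨ha, hb⟩ =>
    hS (hT.isLinearSpace fun w hw => (hab w hw).elim
      (fun h => zeroStabOrbit_subset_nbrs hG ha h) fun h => zeroStabOrbit_subset_nbrs hG hb h)
  have back {u v : V} (hu : u ∈ S.nbrs 0) (h : u ∈ zeroStabOrbit G v) : v ∈ S.nbrs 0 :=
    zeroStabOrbit_subset_nbrs hG hu (zeroStabOrbit_symm h)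
  rcases hab x hx.1.symm with h | h <;> rcases hab z hz.1.symm with h' | h'
  · exact zeroStabOrbit_trans (zeroStabOrbit_symm h) h'
  · exact (key ⟨back hx h, back hz h'⟩).elim
  · exact (key ⟨back hz h', back hx h⟩).elim
  · exact zeroStabOrbit_trans (zeroStabOrbit_symm h) h'

/-- If the stabiliser of `0` is transitive on the neighbours of `0`, it is transitive on the
flags formed by a line through `0` and a nonzero point of it. -/
theorem PLS.exists_image_eq (hG : G ≤ S.aut)
    (horb : ∀ x ∈ S.nbrs 0, S.nbrs 0 = zeroStabOrbit G x) {L M : Set V} (hL : L ∈ S.lines)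
    (hM : M ∈ S.lines) (hL0 : 0 ∈ L) (hM0 : 0 ∈ M) {x y : V} (hx : x ∈ L) (hy : y ∈ M)
    (hx0 : x ≠ 0) (hy0 : y ≠ 0) : ∃ g ∈ G, g 0 = 0 ∧ g x = y ∧ g '' L = M := by
  have hxS : x ∈ S.nbrs 0 := ⟨hx0.symm, L, hL, hL0, hx⟩
  have hyS : y ∈ S.nbrs 0 := ⟨hy0.symm, M, hM, hM0, hy⟩
  rw [horb x hxS] at hyS
  obtain ⟨g, hg, h0, rfl⟩ := hyS
  exact ⟨g, hg, h0, rfl, S.unique_of_pair _ (image_mem_lines (hG hg) hL) _ hM 0 _ hy0.symm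
    ⟨0, hL0, h0⟩ ⟨x, hx, rfl⟩ hM0 hy⟩

theorem PLS.ncard_line_eq (hT : S.IsTranslationInvariant) (hG : G ≤ S.aut)
    (horb : ∀ x ∈ S.nbrs 0, S.nbrs 0 = zeroStabOrbit G x) {L M : Set V} (hL : L ∈ S.lines)
    (hM : M ∈ S.lines) : M.ncard = L.ncard := by
  obtain ⟨a, ha, -⟩ := S.exists_mem_ne hL 0
  obtain ⟨b, hb, hba⟩ := S.exists_mem_ne hL a
  obtain ⟨c, hc, -⟩ := S.exists_mem_ne hM 0
  obtain ⟨d, hd, hdc⟩ := S.exists_mem_ne hM c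
  obtain ⟨hL', hL0, hLb⟩ := hT.exists_line hL ha hb
  obtain ⟨hM', hM0, hMd⟩ := hT.exists_line hM hc hd
  obtain ⟨g, -, -, -, h⟩ := exists_image_eq hG horb hL' hM' hL0 hM0 hLb hMd
    (sub_ne_zero.2 hba) (sub_ne_zero.2 hdc)
  have h' := congrArg Set.ncard h
  rwa [Set.ncard_image_of_injective _ g.injective,
    Set.ncard_image_of_injective _ (add_left_injective _),
    Set.ncard_image_of_injective _ (add_left_injective _), eq_comm] at h'

/-- If some nonzero translation fixes a line, then every line through `0` is invariant under
translation by each of its points. -/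
theorem PLS.image_add_eq_of_mem (hT : S.IsTranslationInvariant) (hG : G ≤ S.aut)
    (hadd : ∀ g ∈ G, g 0 = 0 → ∀ x y : V, g (x + y) = g x + g y)
    (horb : ∀ x ∈ S.nbrs 0, S.nbrs 0 = zeroStabOrbit G x) {v : V} (hv : v ≠ 0) {L : Set V}
    (hL : L ∈ S.lines) (hLv : (fun y : V => y + v) '' L = L) {M : Set V} (hM : M ∈ S.lines)
    (hM0 : 0 ∈ M) {x : V} (hx : x ∈ M) : (fun y : V => y + x) '' M = M := by
  rcases eq_or_ne x 0 with rfl | hx0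
  · simp
  obtain ⟨a, ha, -⟩ := S.exists_mem_ne hL 0
  have hav : a + v ∈ L := hLv ▸ Set.mem_image_of_mem _ ha
  obtain ⟨hL', hL0, hLb⟩ := hT.exists_line hL ha hav
  rw [add_sub_cancel_left] at hLb
  obtain ⟨g, hg, hg0, rfl, rfl⟩ := exists_image_eq hG horb hL' hM hL0 hM0 hLb hx hv hx0
  have hswap : (fun y : V => y + v) '' ((fun y : V => y + -a) '' L) =
      (fun y : V => y + -a) '' L := by
    conv_rhs => rw [← hLv]
    simp only [Set.image_image, add_right_comm]
  conv_rhs => rw [← hswap]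
  rw [Set.image_image, Set.image_image g]
  simp only [hadd g hg hg0]

end ZeroStabOrbit

/-- A set containing `0` that is invariant under translation by each of its points is a
subspace. -/
theorem exists_submodule_coe_eq {p : ℕ} [NeZero p] {V : Type*} [AddCommGroup V]
    [Module (ZMod p) V] {M : Set V} (h0 : 0 ∈ M)
    (h : ∀ x ∈ M, (fun y : V => y + x) '' M = M) :
    ∃ W : Submodule (ZMod p) V, (W : Set V) = M := by
  have hadd {x y : V} (hx : x ∈ M) (hy : y ∈ M) : x + y ∈ M := h y hy ▸ ⟨x, hx, rfl⟩
  have hneg {x : V} (hx : x ∈ M) : -x ∈ M := by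
    obtain ⟨y, hy, hyx⟩ : (0 : V) ∈ (fun y : V => y + x) '' M := (h x hx).symm ▸ h0
    rwa [← eq_neg_of_add_eq_zero_left hyx]
  exact ⟨AddSubgroup.toZModSubmodule p ⟨⟨⟨M, hadd⟩, h0⟩, hneg⟩, rfl⟩

/-- **Lemma 2.20.** Let `S = (V, 𝓛)` be a `G`-affine proper partial linear space where
`G` is an affine permutation group of rank 3 on `V = V_d(p)`.  Then either every line is
an affine subspace of `V`, or the translation group acts semiregularly on `𝓛`, all lines
have a common size `k`, and `k(k-1)` divides `|x^{G₀}|` for every `x ∈ S(0)`. -/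
theorem affine_or_semiregular
    {p d : ℕ} (hp : p.Prime) (hd : 1 ≤ d)
    (V : Type*) [AddCommGroup V] [Module (ZMod p) V] [Finite V]
    (hdim : Module.finrank (ZMod p) V = d)
    (S : PLS V) (hproper : S.IsProper)
    (G : Subgroup (Equiv.Perm V)) (hG : G ≤ S.aut)
    (haff : IsAffinePermGroup G) (hrank : HasTwoZeroStabOrbits G) :
    (∀ L ∈ S.lines, ∃ (W : Submodule (ZMod p) V) (v : V),
        L = (fun w : V => w + v) '' (W : Set V)) ∨
    ((∀ v : V, v ≠ 0 → ∀ L ∈ S.lines, (fun y : V => y + v) '' L ≠ L) ∧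
      ∃ k : ℕ, (∀ L ∈ S.lines, L.ncard = k) ∧
        ∀ x ∈ S.nbrs 0, k * (k - 1) ∣ (zeroStabOrbit G x).ncard) := by
  have : NeZero p := ⟨hp.ne_zero⟩
  have hT : S.IsTranslationInvariant := fun v _ hL => PLS.image_mem_lines (hG (haff.1 v)) hL
  have horb : ∀ x ∈ S.nbrs 0, S.nbrs 0 = zeroStabOrbit G x := fun _ hx =>
    PLS.nbrs_zero_eq_zeroStabOrbit hT hproper.1 hG hrank hx
  by_cases hsemi : ∀ v : V, v ≠ 0 → ∀ L ∈ S.lines, (fun y : V => y + v) '' L ≠ L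
  · refine Or.inr ⟨hsemi, ?_⟩
    obtain ⟨L, hL, -⟩ : ∃ L ∈ S.lines, L.ncard ≠ 2 := by
      simpa [PLS.IsGraph] using hproper.2
    have hk : ∀ M ∈ S.lines, M.ncard = L.ncard := fun M hM =>
      PLS.ncard_line_eq hT hG horb hL hM
    refine ⟨L.ncard, hk, fun x hx => ?_⟩
    rw [← horb x hx]
    exact hT.dvd_ncard_nbrs_zero hsemi hk
  · refine Or.inl fun M hM => ?_
    push Not at hsemi
    obtain ⟨v, hv, L, hL, hLv⟩ := hsemi
    obtain ⟨a, ha, -⟩ := S.exists_mem_ne hM 0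
    obtain ⟨hM', hM0, -⟩ := hT.exists_line hM ha ha
    obtain ⟨W, hW⟩ := exists_submodule_coe_eq (p := p) hM0 fun x hx =>
      PLS.image_add_eq_of_mem hT hG haff.2 horb hv hL hLv hM' hM0 hx
    refine ⟨W, a, ?_⟩
    rw [hW, Set.image_image]
    simp
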